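/- Let I = (n_1, …, n_l) be a composition of n and let GL_I ≤ GL_n(F_q) be the associated parabolic subgroup (the group G_I with G_i = GL_{n_i}(F_q) for every i). Then the monomial Π_{i=1}^l Π_{j=1}^{n_i} x_{m_{i−1}+j}^{q^{m_i} − q^{m_i − j} − 1} generates a block basis for the coinvariant algebra P_{GL_I}: the set of all its monomial factors projects to an F_q-basis of P/I_{GL_I}. -/

import Mathlib

open MvPolynomial Finset

/-- The action of a matrix `g` on `F_q[x_1, …, x_n]`: the algebra map sending
`x_j` to `Σ_i g_{ij} x_i`. -/
noncomputable def matAct {K : Type*} [Field K] {n : ℕ} (g : Matrix (Fin n) (Fin n) K) :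
    MvPolynomial (Fin n) K →ₐ[K] MvPolynomial (Fin n) K :=
  aeval fun j => ∑ i, C (g i j) * X i

/-- The subalgebra of polynomials invariant under every matrix in `G`. -/
noncomputable def invariants {K : Type*} [Field K] {n : ℕ} (G : Set (GL (Fin n) K)) :
    Subalgebra K (MvPolynomial (Fin n) K) where
  carrier := {f | ∀ g ∈ G, matAct ((g : GL (Fin n) K) : Matrix (Fin n) (Fin n) K) f = f}
  mul_mem' := by
    intro a b ha hb g hg
    rw [map_mul, ha g hg, hb g hg]
  add_mem' := by
    intro a b ha hb g hg
    rw [map_add, ha g hg, hb g hg]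
  algebraMap_mem' := by
    intro c g hg
    simp [matAct]

/-- The ideal generated by the homogeneous `G`-invariants of positive degree;
the quotient by it is the algebra of coinvariants. -/
noncomputable def coinvIdeal {K : Type*} [Field K] {n : ℕ} (G : Set (GL (Fin n) K)) :
    Ideal (MvPolynomial (Fin n) K) :=
  Ideal.span {f | f ∈ invariants G ∧ ∃ d, 0 < d ∧ f.IsHomogeneous d}

/-- `tauf m s` is the largest partial sum `m i` which is `≤ s`; for `s` in the
`(j+1)`-st block this is `m j`. -/
def tauf {l : ℕ} (m : Fin (l + 1) → ℕ) (s : ℕ) : ℕ :=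
  ((Finset.univ : Finset (Fin (l + 1))).filter fun i => m i ≤ s).sup m

/-- `U_I`: block upper triangular matrices whose diagonal blocks are identity
matrices (blocks determined by the partial sums `m`). -/
def USet (K : Type*) [Field K] {l : ℕ} (n : ℕ) (m : Fin (l + 1) → ℕ) :
    Set (GL (Fin n) K) :=
  {g | ∀ s t : Fin n, tauf m (t : ℕ) ≤ tauf m (s : ℕ) →
    (g : Matrix (Fin n) (Fin n) K) s t = if s = t then 1 else 0}

/-- The global index of the `j`-th variable of the `i`-th block. -/
def emb {l : ℕ} (n : ℕ) (m : Fin (l + 1) → ℕ) (hmono : StrictMono m)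
    (hlast : m (Fin.last l) = n) (i : Fin l)
    (j : Fin (m i.succ - m i.castSucc)) : Fin n :=
  ⟨m i.castSucc + (j : ℕ), by
    have h1 : m i.succ ≤ n := hlast ▸ hmono.monotone (Fin.le_last _)
    have h2 := j.2
    omega⟩

/-- `G_I`: block upper triangular matrices whose `i`-th diagonal block lies in
`G i` (and whose entries above the diagonal blocks are arbitrary). -/
def GSet (K : Type*) [Field K] {l : ℕ} (n : ℕ) (m : Fin (l + 1) → ℕ)
    (hmono : StrictMono m) (hlast : m (Fin.last l) = n)
    (G : (i : Fin l) → Subgroup (GL (Fin (m i.succ - m i.castSucc)) K)) :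
    Set (GL (Fin n) K) :=
  {g | (∀ s t : Fin n, tauf m (t : ℕ) < tauf m (s : ℕ) →
          (g : Matrix (Fin n) (Fin n) K) s t = 0) ∧
    ∀ i : Fin l, ∃ h ∈ G i, ∀ j k : Fin (m i.succ - m i.castSucc),
      (g : Matrix (Fin n) (Fin n) K) (emb n m hmono hlast i j) (emb n m hmono hlast i k) =
        (h : Matrix (Fin (m i.succ - m i.castSucc)) (Fin (m i.succ - m i.castSucc)) K) j k}

/-- `Fpoly K k hk t = Π_{(λ_1,…,λ_k) ∈ K^k} (t + λ_1 x_1 + ⋯ + λ_k x_k)`. -/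
noncomputable def Fpoly (K : Type*) [Field K] [Fintype K] {n : ℕ} (k : ℕ) (hk : k ≤ n)
    (t : MvPolynomial (Fin n) K) : MvPolynomial (Fin n) K :=
  ∏ c : Fin k → K, (t + ∑ i : Fin k, C (c i) * X (Fin.castLE hk i))

/-- `v_{i,j} = F_{m_{i-1}}(x_{m_{i-1}+j})`. -/
noncomputable def vij (K : Type*) [Field K] [Fintype K] {l : ℕ} (n : ℕ)
    (m : Fin (l + 1) → ℕ) (hmono : StrictMono m) (hlast : m (Fin.last l) = n)
    (i : Fin l) (j : Fin (m i.succ - m i.castSucc)) : MvPolynomial (Fin n) K :=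
  Fpoly K (m i.castSucc)
    (le_trans (hmono.monotone (Fin.le_last _)) (le_of_eq hlast))
    (X (emb n m hmono hlast i j))

theorem homogeneousComponent_mul_isHomogeneous {σ R : Type*} [CommSemiring R] (a : MvPolynomial σ R)
    {f : MvPolynomial σ R} {e : ℕ} (hf : f.IsHomogeneous e) (d : ℕ) :
    homogeneousComponent d (a * f) =
      if e ≤ d then homogeneousComponent (d - e) a * f else 0 := by
  conv_lhs => rw [← sum_homogeneousComponent a, Finset.sum_mul, map_sum]
  have h : ∀ k, homogeneousComponent d (homogeneousComponent k a * f) =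
      if d = k + e then homogeneousComponent k a * f else 0 := fun k =>
    homogeneousComponent_of_mem ((homogeneousComponent_isHomogeneous k a).mul hf)
  simp only [h]
  split_ifs with hed
  · rw [Finset.sum_eq_single (d - e)]
    · rw [if_pos (by omega)]
    · intro k _ hk
      rw [if_neg (by omega)]
    · intro hk
      rw [if_pos (by omega), homogeneousComponent_eq_zero, zero_mul]
      rw [Finset.mem_range] at hk
      omega
  · exact Finset.sum_eq_zero fun k _ => if_neg (by omega)

/-- Graded Nakayama: monomials spanning the coinvariants span the polynomial ring over the
invariants. -/
theorem span_invariants_eq_top {K : Type*} [Field K] {n : ℕ} (G : Set (GL (Fin n) K))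
    {ι : Type*} (e : ι → Fin n →₀ ℕ)
    (hspan : Submodule.span K (Set.range fun i =>
      Ideal.Quotient.mk (coinvIdeal G) (monomial (e i) 1)) = ⊤) :
    Submodule.span (invariants G) (Set.range fun i => (monomial (e i) 1 : MvPolynomial (Fin n) K))
      = ⊤ := by
  set M := Submodule.span (invariants G)
    (Set.range fun i => (monomial (e i) 1 : MvPolynomial (Fin n) K)) with hM
  have hsplit : ∀ f : MvPolynomial (Fin n) K, ∃ g ∈ Submodule.span K
      (Set.range fun i => (monomial (e i) 1 : MvPolynomial (Fin n) K)), f - g ∈ coinvIdeal G := by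
    intro f
    have hf : Ideal.Quotient.mkₐ K (coinvIdeal G) f ∈ Submodule.span K (Set.range fun i =>
      Ideal.Quotient.mk (coinvIdeal G) (monomial (e i) 1)) := hspan ▸ Submodule.mem_top
    have himg : (Set.range fun i => Ideal.Quotient.mk (coinvIdeal G) (monomial (e i) 1)) =
        (Ideal.Quotient.mkₐ K (coinvIdeal G)).toLinearMap ''
          (Set.range fun i => (monomial (e i) 1 : MvPolynomial (Fin n) K)) := by
      rw [← Set.range_comp]; rfl
    rw [himg, Submodule.span_image] at hf
    obtain ⟨g, hg, hgf⟩ := hf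
    exact ⟨g, hg, Ideal.Quotient.eq.1 hgf.symm⟩
  have hcomp : ∀ d, ∀ f : MvPolynomial (Fin n) K, homogeneousComponent d f ∈ M := by
    intro d
    induction d using Nat.strong_induction_on with
    | _ d ih =>
    have hI : ∀ x ∈ coinvIdeal G, ∀ a, homogeneousComponent d (a * x) ∈ M := by
      intro x hx
      refine Submodule.span_induction (p := fun x _ => ∀ a, homogeneousComponent d (a * x) ∈ M)
        ?_ ?_ ?_ ?_ hx
      · rintro f ⟨hfG, k, hk, hf⟩ a
        rw [homogeneousComponent_mul_isHomogeneous a hf]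
        split_ifs with hkd
        · rw [mul_comm]
          exact M.smul_mem (⟨f, hfG⟩ : invariants G) (ih (d - k) (by omega) a)
        · exact M.zero_mem
      · simp
      · intro x y _ _ hx hy a
        rw [mul_add, map_add]
        exact M.add_mem (hx a) (hy a)
      · intro b x _ hx a
        rw [smul_eq_mul, ← mul_assoc]
        exact hx _
    intro f
    obtain ⟨g, hg, hfg⟩ := hsplit f
    have h1 := hI _ hfg 1
    rw [one_mul, map_sub] at h1
    rw [← sub_add_cancel (homogeneousComponent d f) (homogeneousComponent d g)]
    refine M.add_mem h1 ?_
    clear h1 hfg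
    induction hg using Submodule.span_induction with
    | mem x hx =>
      obtain ⟨i, rfl⟩ := hx
      rw [homogeneousComponent_of_mem (isHomogeneous_monomial (1 : K) rfl)]
      split_ifs
      · exact Submodule.subset_span ⟨i, rfl⟩
      · exact M.zero_mem
    | zero => simp
    | add x y _ _ hx hy => rw [map_add]; exact M.add_mem hx hy
    | smul c x _ hx =>
      rw [map_smul, ← algebraMap_smul (invariants G) c]
      exact M.smul_mem _ hx
  rw [eq_top_iff]
  intro f _
  rw [← sum_homogeneousComponent f]
  exact M.sum_mem fun d _ => hcomp d f

theorem matAct_X {K : Type*} [Field K] {n : ℕ} (g : Matrix (Fin n) (Fin n) K) (j : Fin n) :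
    matAct g (X j) = ∑ i, C (g i j) * X i := by
  simp [matAct]

theorem coeff_single_sum_C_mul_X {R σ : Type*} [CommSemiring R] [Fintype σ] (c : σ → R) (i : σ) :
    coeff (Finsupp.single i 1) (∑ s, C (c s) * X s) = c i := by
  classical
  simp [coeff_sum, coeff_C_mul, coeff_X, Finsupp.single_left_inj]

theorem matAct_injective {K : Type*} [Field K] {n : ℕ} :
    Function.Injective (matAct : Matrix (Fin n) (Fin n) K → _) := by
  intro g h hgh
  ext i j
  have := congrArg (fun φ => coeff (Finsupp.single i 1) (φ (X j))) hgh
  simpa only [matAct_X, coeff_single_sum_C_mul_X] using this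

/-- The coinvariants of `G` have dimension at least `|G|`. -/
theorem card_le_card_of_span_coinvariants {K : Type*} [Field K] [Finite K] {n : ℕ}
    (G : Set (GL (Fin n) K)) {ι : Type*} [Fintype ι] (e : ι → Fin n →₀ ℕ)
    (hspan : Submodule.span K (Set.range fun i =>
      Ideal.Quotient.mk (coinvIdeal G) (monomial (e i) 1)) = ⊤) :
    Nat.card G ≤ Fintype.card ι := by
  classical
  have := Fintype.ofFinite G
  let b : ι → MvPolynomial (Fin n) K := fun i => monomial (e i) 1
  let act : G → (MvPolynomial (Fin n) K →* MvPolynomial (Fin n) K) := fun g =>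
    (matAct ((g : GL (Fin n) K) : Matrix (Fin n) (Fin n) K) :
      MvPolynomial (Fin n) K →* MvPolynomial (Fin n) K)
  have hact : Function.Injective act := by
    intro g h hgh
    apply Subtype.ext
    apply Units.ext
    apply matAct_injective
    ext1 j
    exact DFunLike.congr_fun hgh (X j)
  have hli := (linearIndependent_monoidHom (MvPolynomial (Fin n) K)
    (MvPolynomial (Fin n) K)).comp act hact
  have key : LinearIndependent (MvPolynomial (Fin n) K) (fun g : G => fun i => act g (b i)) := by
    rw [Fintype.linearIndependent_iff] at hli ⊢
    intro a ha
    apply hli a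
    ext1 f
    have hf : f ∈ Submodule.span (invariants G) (Set.range b) := by
      rw [span_invariants_eq_top G e hspan]; trivial
    induction hf using Submodule.span_induction with
    | mem x hx =>
      obtain ⟨i, rfl⟩ := hx
      simpa using congrFun ha i
    | zero => simp [act]
    | add x y _ _ hx hy =>
      simp only [Function.comp_apply, Finset.sum_apply, Pi.smul_apply, Pi.zero_apply,
        smul_eq_mul] at hx hy ⊢
      have : ∀ g, act g (x + y) = act g x + act g y := fun g => map_add (matAct _) x y
      simp only [this, mul_add, Finset.sum_add_distrib, hx, hy, add_zero]
    | smul h x _ hx =>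
      simp only [Function.comp_apply, Finset.sum_apply, Pi.smul_apply, Pi.zero_apply,
        smul_eq_mul] at hx ⊢
      have : ∀ g, act g (h • x) = h * act g x := fun g => by
        change act g (h.1 * x) = _
        rw [map_mul]
        congr 1
        exact h.2 g g.2
      simp only [this, mul_left_comm _ (h : MvPolynomial (Fin n) K), ← Finset.mul_sum, hx,
        mul_zero]
  have := key.fintype_card_le_finrank
  rwa [Module.finrank_fintype_fun_eq_card, ← Nat.card_eq_fintype_card] at this

/-- If each `y t` is a root of a monic polynomial of degree `d t` over the subalgebra generated by
the `y s` of smaller rank, the monomials with exponents below `d` span. -/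
theorem adjoin_le_span_of_triangular {K Q τ : Type*} [Field K] [CommRing Q] [Algebra K Q]
    [Fintype τ] (y : τ → Q) (d : τ → ℕ) (hd : ∀ t, 0 < d t) (ρ : τ → ℕ)
    (hρ : Function.Injective ρ)
    (H : ∀ t, ∃ p : Polynomial (Algebra.adjoin K (y '' {s | ρ s < ρ t})),
      p.Monic ∧ p.natDegree = d t ∧ Polynomial.aeval (y t) p = 0) (k : ℕ) :
    Subalgebra.toSubmodule (Algebra.adjoin K (y '' {s | ρ s < k})) ≤
      Submodule.span K {x | ∃ b : τ → ℕ, (∀ t, b t < d t) ∧ (∀ t, k ≤ ρ t → b t = 0) ∧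
        ∏ t, y t ^ b t = x} := by
  classical
  induction k with
  | zero =>
    have : y '' {s | ρ s < 0} = ∅ := by simp
    rw [this, Algebra.adjoin_empty, Algebra.toSubmodule_bot, Submodule.one_eq_span]
    apply Submodule.span_mono
    rintro _ rfl
    exact ⟨0, hd, fun _ _ => rfl, by simp⟩
  | succ k ih =>
    by_cases ht : ∃ t, ρ t = k
    · obtain ⟨t, rfl⟩ := ht
      obtain ⟨p, hp, hpd, hpy⟩ := H t
      have hset : {s | ρ s < ρ t + 1} = {s | ρ s < ρ t} ∪ {t} := by
        ext s
        simp only [Set.mem_ofPred_eq, Set.union_singleton, Set.mem_insert_iff, ← hρ.eq_iff (a := s)]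
        omega
      rw [hset, Set.image_union, Set.image_singleton, Algebra.adjoin_union_eq_adjoin_adjoin]
      intro f hf
      rw [Subalgebra.mem_toSubmodule, Subalgebra.mem_restrictScalars,
        Algebra.adjoin_singleton_eq_range_aeval] at hf
      obtain ⟨g, rfl⟩ := hf
      have hp1 : p ≠ 1 := by
        rintro rfl
        have := hd t
        simp at hpd
        omega
      have hg : Polynomial.aeval (y t) g = Polynomial.aeval (y t) (g %ₘ p) := by
        conv_lhs => rw [← Polynomial.modByMonic_add_div g p]
        simp [hpy]
      have hlt := Polynomial.natDegree_modByMonic_lt g hp hp1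
      change Polynomial.aeval (y t) g ∈ _
      rw [hg, Polynomial.aeval_eq_sum_range' hlt]
      refine Submodule.sum_mem _ fun i hi => ?_
      have hi : i < d t := by simpa [hpd] using hi
      have hc := ih ((g %ₘ p).coeff i).2
      change ((g %ₘ p).coeff i : Q) * y t ^ i ∈ _
      generalize ((g %ₘ p).coeff i : Q) = c at hc
      induction hc using Submodule.span_induction with
      | mem x hx =>
        obtain ⟨b, hb, hb0, rfl⟩ := hx
        refine Submodule.subset_span ⟨Function.update b t i, ?_, ?_, ?_⟩
        · intro s
          rcases eq_or_ne s t with rfl | hs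
          · simpa using hi
          · simpa [hs] using hb s
        · intro s hs
          have : s ≠ t := by rintro rfl; omega
          simpa [this] using hb0 s (by omega)
        · rw [← Finset.mul_prod_erase _ _ (Finset.mem_univ t),
            ← Finset.mul_prod_erase _ (fun s => y s ^ b s) (Finset.mem_univ t),
            hb0 t le_rfl, pow_zero, one_mul, Function.update_self, mul_comm]
          congr 1
          refine Finset.prod_congr rfl fun s hs => ?_
          rw [Function.update_of_ne (Finset.ne_of_mem_erase hs)]
      | zero => simp
      | add u v _ _ hu hv => rw [add_mul]; exact Submodule.add_mem _ hu hv
      | smul a u _ hu => rw [smul_mul_assoc]; exact Submodule.smul_mem _ a hu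
    · have hset : {s | ρ s < k + 1} = {s | ρ s < k} := by
        ext s
        have : ρ s ≠ k := fun h => ht ⟨s, h⟩
        simp only [Set.mem_ofPred_eq]
        omega
      rw [hset]
      refine ih.trans (Submodule.span_mono ?_)
      rintro _ ⟨b, hb, hb0, rfl⟩
      exact ⟨b, hb, fun s hs => hb0 s (by omega), rfl⟩

/-- The linear form with coefficient vector `c`. -/
noncomputable def linForm {K : Type*} [Field K] {n : ℕ} (c : Fin n → K) :
    MvPolynomial (Fin n) K := ∑ s, C (c s) * X s

theorem isHomogeneous_linForm {K : Type*} [Field K] {n : ℕ} (c : Fin n → K) :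
    (linForm c).IsHomogeneous 1 :=
  IsHomogeneous.sum _ _ _ fun s _ => by
    simpa using (isHomogeneous_C (Fin n) (c s)).mul (isHomogeneous_X K s)

theorem matAct_linForm {K : Type*} [Field K] {n : ℕ} (g : Matrix (Fin n) (Fin n) K)
    (c : Fin n → K) : matAct g (linForm c) = linForm (g.mulVec c) := by
  simp only [linForm, map_sum, map_mul, matAct_X, Matrix.mulVec, dotProduct, Finset.mul_sum,
    Finset.sum_mul]
  rw [Finset.sum_comm]
  refine Finset.sum_congr rfl fun i _ => Finset.sum_congr rfl fun j _ => ?_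
  have : matAct g (C (c j)) = C (c j) := by simp [matAct]
  rw [this]
  ring

/-- The coefficient vectors supported on `A`. -/
def vecsOn (K : Type*) [Field K] [Fintype K] [DecidableEq K] {n : ℕ} (A : Finset (Fin n)) :
    Finset (Fin n → K) := Fintype.piFinset fun s => if s ∈ A then Finset.univ else {0}

theorem mem_vecsOn {K : Type*} [Field K] [Fintype K] [DecidableEq K] {n : ℕ}
    {A : Finset (Fin n)} {c : Fin n → K} : c ∈ vecsOn K A ↔ ∀ s ∉ A, c s = 0 := by
  rw [vecsOn, Fintype.mem_piFinset]
  refine forall_congr' fun s => ?_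
  split_ifs with h <;> simp [h]

theorem card_vecsOn {K : Type*} [Field K] [Fintype K] [DecidableEq K] {n : ℕ}
    (A : Finset (Fin n)) : (vecsOn K A).card = Fintype.card K ^ A.card := by
  rw [vecsOn, Fintype.card_piFinset]
  simp only [apply_ite Finset.card, Finset.card_univ, Finset.card_singleton]
  rw [Finset.prod_ite_mem_eq]
  simp

/-- The polynomial whose roots are the negatives of the linear forms with coefficients in `s`. -/
noncomputable def orbitPoly {K : Type*} [Field K] {n : ℕ} (s : Finset (Fin n → K)) :
    Polynomial (MvPolynomial (Fin n) K) :=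
  ∏ c ∈ s, (Polynomial.X + Polynomial.C (linForm c))

theorem monic_orbitPoly {K : Type*} [Field K] {n : ℕ} (s : Finset (Fin n → K)) :
    (orbitPoly s).Monic :=
  Polynomial.monic_prod_of_monic _ _ fun _ _ => Polynomial.monic_X_add_C _

theorem natDegree_orbitPoly {K : Type*} [Field K] {n : ℕ} (s : Finset (Fin n → K)) :
    (orbitPoly s).natDegree = s.card := by
  rw [orbitPoly, Polynomial.natDegree_prod_of_monic _ _ fun _ _ => Polynomial.monic_X_add_C _]
  simp

theorem isHomogeneous_coeff_orbitPoly {K : Type*} [Field K] {n : ℕ} (s : Finset (Fin n → K))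
    {k : ℕ} (hk : k ≤ s.card) : ((orbitPoly s).coeff k).IsHomogeneous (s.card - k) := by
  rw [orbitPoly, Finset.prod_X_add_C_coeff s _ hk]
  refine IsHomogeneous.sum _ _ _ fun t ht => ?_
  have := IsHomogeneous.prod t linForm (fun _ => 1) fun c _ => isHomogeneous_linForm (K := K) c
  simpa [(Finset.mem_powersetCard.1 ht).2] using this

theorem map_matAct_orbitPoly {K : Type*} [Field K] {n : ℕ} (g : GL (Fin n) K)
    (s : Finset (Fin n → K)) (hs : ∀ c ∈ s, (g : Matrix (Fin n) (Fin n) K).mulVec c ∈ s) :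
    (orbitPoly s).map (matAct (g : Matrix (Fin n) (Fin n) K)).toRingHom = orbitPoly s := by
  have hinj : Function.Injective (g : Matrix (Fin n) (Fin n) K).mulVec :=
    Matrix.mulVec_injective_of_isUnit g.isUnit
  rw [orbitPoly, Polynomial.map_prod]
  refine Finset.prod_bij (fun c _ => (g : Matrix (Fin n) (Fin n) K).mulVec c) hs
    (fun _ _ _ _ h => hinj h) ?_ ?_
  · intro c hc
    obtain ⟨a, ha, hac⟩ := Finset.surj_on_of_inj_on_of_card_le
      (fun c (_ : c ∈ s) => (g : Matrix (Fin n) (Fin n) K).mulVec c) hs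
      (fun _ _ _ _ h => hinj h) le_rfl c hc
    exact ⟨a, ha, hac.symm⟩
  · intro c _
    simp [matAct_linForm]

theorem map_mk_orbitPoly {K : Type*} [Field K] {n : ℕ} (G : Set (GL (Fin n) K))
    (s : Finset (Fin n → K))
    (hs : ∀ g ∈ G, ∀ c ∈ s, (g : Matrix (Fin n) (Fin n) K).mulVec c ∈ s) :
    (orbitPoly s).map (Ideal.Quotient.mk (coinvIdeal G)) = Polynomial.X ^ s.card := by
  ext k
  rw [Polynomial.coeff_map, Polynomial.coeff_X_pow]
  rcases lt_trichotomy k s.card with hk | rfl | hk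
  · rw [if_neg hk.ne, Ideal.Quotient.eq_zero_iff_mem]
    refine Ideal.subset_span ⟨fun g hg => ?_, s.card - k, by omega,
      isHomogeneous_coeff_orbitPoly s hk.le⟩
    conv_rhs => rw [← map_matAct_orbitPoly g s (hs g hg), Polynomial.coeff_map]
    rfl
  · have := (monic_orbitPoly s).coeff_natDegree
    rw [natDegree_orbitPoly] at this
    simp [this]
  · rw [if_neg hk.ne', Polynomial.coeff_eq_zero_of_natDegree_lt (by rwa [natDegree_orbitPoly]),
      map_zero]

/-- If the span of the variables in `A` is stable under `G`, `B ⊆ A` and `t ∈ A \ B`, then `x_t`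
satisfies a monic equation of degree `q^|A| - q^|B|` over the subalgebra of the coinvariants
generated by the variables in `B`. -/
theorem exists_monic_aeval_eq_zero {K : Type*} [Field K] [Fintype K] {n : ℕ}
    (G : Set (GL (Fin n) K)) (A B : Finset (Fin n)) (hBA : B ⊆ A)
    [Nontrivial (MvPolynomial (Fin n) K ⧸ coinvIdeal G)]
    (hA : ∀ g ∈ G, ∀ s t : Fin n, t ∈ A → s ∉ A → (g : Matrix (Fin n) (Fin n) K) s t = 0)
    (t : Fin n) (htA : t ∈ A) (htB : t ∉ B)
    (R : Subalgebra K (MvPolynomial (Fin n) K ⧸ coinvIdeal G))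
    (hR : ∀ s ∈ B, Ideal.Quotient.mk (coinvIdeal G) (X s) ∈ R) :
    ∃ p : Polynomial R, p.Monic ∧ p.natDegree = Fintype.card K ^ A.card - Fintype.card K ^ B.card ∧
      Polynomial.aeval (Ideal.Quotient.mk (coinvIdeal G) (X t)) p = 0 := by
  classical
  set φ := Ideal.Quotient.mk (coinvIdeal G) with hφ
  have hmem : ∀ c ∈ vecsOn K B, φ (linForm c) ∈ R := by
    intro c hc
    rw [linForm, map_sum]
    refine sum_mem fun s _ => ?_
    rw [map_mul]
    by_cases hs : s ∈ B
    · exact mul_mem (R.algebraMap_mem (c s)) (hR s hs)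
    · simp [mem_vecsOn.1 hc s hs]
  have hsub : vecsOn K B ⊆ vecsOn K A := fun c hc =>
    mem_vecsOn.2 fun s hs => mem_vecsOn.1 hc s fun h => hs (hBA h)
  have hprod : (orbitPoly (vecsOn K B)).map φ * (orbitPoly (vecsOn K A \ vecsOn K B)).map φ =
      Polynomial.X ^ (vecsOn K A).card := by
    rw [← map_mk_orbitPoly G, ← Polynomial.map_mul, orbitPoly, orbitPoly, orbitPoly, mul_comm,
      Finset.prod_sdiff hsub]
    intro g hg c hc
    refine mem_vecsOn.2 fun s hs => ?_
    rw [Matrix.mulVec, dotProduct]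
    refine Finset.sum_eq_zero fun u _ => ?_
    by_cases hu : u ∈ A
    · rw [hA g hg s u hu hs, zero_mul]
    · rw [mem_vecsOn.1 hc u hu, mul_zero]
  let DB : Polynomial R := ∏ c ∈ (vecsOn K B).attach,
    (Polynomial.X + Polynomial.C ⟨φ (linForm c.1), hmem c.1 c.2⟩)
  have hDB : DB.Monic := Polynomial.monic_prod_of_monic _ _ fun _ _ => Polynomial.monic_X_add_C _
  have hDBmap : DB.map (algebraMap R _) = (orbitPoly (vecsOn K B)).map φ := by
    rw [orbitPoly, Polynomial.map_prod, Polynomial.map_prod, ← Finset.prod_attach (vecsOn K B)]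
    refine Finset.prod_congr rfl fun c _ => ?_
    simp
  have hmap : ((Polynomial.X ^ (vecsOn K A).card : Polynomial R) /ₘ DB).map (algebraMap R _) =
      (orbitPoly (vecsOn K A \ vecsOn K B)).map φ := by
    rw [Polynomial.map_divByMonic _ hDB, Polynomial.map_pow, Polynomial.map_X, ← hprod, hDBmap,
      Polynomial.mul_divByMonic_cancel_left _ ((monic_orbitPoly _).map φ)]
  have hinj : Function.Injective (algebraMap R (MvPolynomial (Fin n) K ⧸ coinvIdeal G)) :=
    Subtype.val_injective
  refine ⟨Polynomial.X ^ (vecsOn K A).card /ₘ DB, ?_, ?_, ?_⟩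
  · apply Polynomial.monic_of_injective hinj
    rw [hmap]
    exact (monic_orbitPoly _).map φ
  · rw [← Polynomial.natDegree_map_eq_of_injective hinj, hmap, (monic_orbitPoly _).natDegree_map,
      natDegree_orbitPoly, Finset.card_sdiff_of_subset hsub, card_vecsOn, card_vecsOn]
  · rw [Polynomial.aeval_def, ← Polynomial.eval_map, hmap, Polynomial.eval_map,
      Polynomial.eval₂_at_apply, orbitPoly, Polynomial.eval_prod]
    have hc : -Pi.single t 1 ∈ vecsOn K A \ vecsOn K B := by
      rw [Finset.mem_sdiff, mem_vecsOn, mem_vecsOn]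
      refine ⟨fun s hs => ?_, fun h => ?_⟩
      · have : s ≠ t := by rintro rfl; exact hs htA
        simp [this]
      · simpa using h t htB
    rw [Finset.prod_eq_zero hc, map_zero]
    simp [linForm, Pi.single_apply, apply_ite, ite_mul]

theorem succ_le_castSucc_of_lt {l : ℕ} {m : Fin (l + 1) → ℕ} (hmono : StrictMono m)
    {i k : Fin l} (h : i < k) : m i.succ ≤ m k.castSucc :=
  hmono.monotone (Fin.succ_le_castSucc_iff.2 h)

theorem exists_block {l : ℕ} {m : Fin (l + 1) → ℕ} (hm0 : m 0 = 0) {s : ℕ} (k : Fin (l + 1))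
    (hs : s < m k) : ∃ i : Fin l, i.castSucc < k ∧ m i.castSucc ≤ s ∧ s < m i.succ := by
  induction k using Fin.induction with
  | zero => omega
  | succ i ih =>
    by_cases h : s < m i.castSucc
    · obtain ⟨j, hj, hjs⟩ := ih h
      exact ⟨j, hj.trans i.castSucc_lt_succ, hjs⟩
    · exact ⟨i, i.castSucc_lt_succ, by omega, hs⟩

theorem emb_val {n l : ℕ} {m : Fin (l + 1) → ℕ} (hmono : StrictMono m)
    (hlast : m (Fin.last l) = n) (i : Fin l) (j : Fin (m i.succ - m i.castSucc)) :
    (emb n m hmono hlast i j : ℕ) = m i.castSucc + j := rfl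

theorem exists_emb_eq {n l : ℕ} {m : Fin (l + 1) → ℕ} (hm0 : m 0 = 0) (hmono : StrictMono m)
    (hlast : m (Fin.last l) = n) (s : Fin n) : ∃ i j, emb n m hmono hlast i j = s := by
  obtain ⟨i, _, h1, h2⟩ := exists_block (s := s) hm0 (Fin.last l) (by omega)
  exact ⟨i, ⟨s - m i.castSucc, by omega⟩, Fin.ext (by rw [emb_val]; simp; omega)⟩

/-- The two blocks `i` and `k` meet only if they are equal. -/
theorem block_eq_of_lt_of_lt {l : ℕ} {m : Fin (l + 1) → ℕ} (hmono : StrictMono m) {i k : Fin l}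
    (h1 : m i.castSucc < m k.succ) (h2 : m k.castSucc < m i.succ) : i = k := by
  rcases lt_trichotomy i k with h | h | h
  · have := succ_le_castSucc_of_lt hmono h
    omega
  · exact h
  · have := succ_le_castSucc_of_lt hmono h
    omega

/-- The variables, grouped by blocks. -/
noncomputable def embEquiv {n l : ℕ} {m : Fin (l + 1) → ℕ} (hm0 : m 0 = 0) (hmono : StrictMono m)
    (hlast : m (Fin.last l) = n) : (Σ i : Fin l, Fin (m i.succ - m i.castSucc)) ≃ Fin n :=
  Equiv.ofBijective (fun a => emb n m hmono hlast a.1 a.2) <| by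
    constructor
    · rintro ⟨i, j⟩ ⟨k, b⟩ h
      have h := congrArg Fin.val h
      simp only [emb_val] at h
      have := j.2
      have := b.2
      obtain rfl := block_eq_of_lt_of_lt hmono (i := i) (k := k) (by omega) (by omega)
      obtain rfl : j = b := Fin.ext (by omega)
      rfl
    · intro s
      obtain ⟨i, j, h⟩ := exists_emb_eq hm0 hmono hlast s
      exact ⟨⟨i, j⟩, h⟩

theorem embEquiv_apply {n l : ℕ} {m : Fin (l + 1) → ℕ} (hm0 : m 0 = 0) (hmono : StrictMono m)
    (hlast : m (Fin.last l) = n) (a : Σ i : Fin l, Fin (m i.succ - m i.castSucc)) :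
    embEquiv hm0 hmono hlast a = emb n m hmono hlast a.1 a.2 := rfl

theorem tauf_emb {n l : ℕ} {m : Fin (l + 1) → ℕ} (hmono : StrictMono m)
    (hlast : m (Fin.last l) = n) (i : Fin l) (j : Fin (m i.succ - m i.castSucc)) :
    tauf m (emb n m hmono hlast i j : ℕ) = m i.castSucc := by
  have hj := j.2
  apply le_antisymm
  · refine Finset.sup_le fun k hk => hmono.monotone ?_
    have hk : m k < m i.succ := by
      have := (Finset.mem_filter.1 hk).2
      rw [emb_val] at this
      omega
    exact Fin.le_castSucc_iff.2 (hmono.lt_iff_lt.1 hk)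
  · exact Finset.le_sup (f := m) (Finset.mem_filter.2 ⟨Finset.mem_univ _, by simp [emb_val]⟩)

/-- Elements of `G_I` stabilise the span of the variables of the first `i` blocks. -/
theorem GSet_apply_eq_zero {K : Type*} [Field K] {n l : ℕ} {m : Fin (l + 1) → ℕ} (hm0 : m 0 = 0)
    (hmono : StrictMono m) (hlast : m (Fin.last l) = n)
    (G : (i : Fin l) → Subgroup (GL (Fin (m i.succ - m i.castSucc)) K)) (i : Fin l)
    {g : GL (Fin n) K} (hg : g ∈ GSet K n m hmono hlast G) {s t : Fin n}
    (ht : (t : ℕ) < m i.succ) (hs : ¬ (s : ℕ) < m i.succ) :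
    (g : Matrix (Fin n) (Fin n) K) s t = 0 := by
  obtain ⟨k, a, rfl⟩ := exists_emb_eq hm0 hmono hlast s
  obtain ⟨k', b, rfl⟩ := exists_emb_eq hm0 hmono hlast t
  have := a.2
  apply hg.1
  rw [tauf_emb, tauf_emb]
  rw [emb_val] at hs ht
  have hlt : i < k := by
    by_contra h
    have : m k.succ ≤ m i.succ := hmono.monotone (Fin.succ_le_succ_iff.2 (not_lt.1 h))
    omega
  have := succ_le_castSucc_of_lt hmono hlt
  omega

theorem card_filter_val_lt {n a : ℕ} (ha : a ≤ n) :
    (Finset.univ.filter fun s : Fin n => (s : ℕ) < a).card = a := by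
  rw [Fin.card_filter_val_lt, min_eq_right ha]

/-- Spanning half: the monomials with exponents below `q^{m_i} - q^{m_i-j}` span the
coinvariants. -/
theorem span_monomials_eq_top {K : Type*} [Field K] [Fintype K] {n l : ℕ} {m : Fin (l + 1) → ℕ}
    (hm0 : m 0 = 0) (hmono : StrictMono m) (hlast : m (Fin.last l) = n)
    (G : (i : Fin l) → Subgroup (GL (Fin (m i.succ - m i.castSucc)) K)) :
    Submodule.span K
      (Set.range (fun b : {b : (i : Fin l) → Fin (m i.succ - m i.castSucc) → ℕ //
          ∀ i j, b i j ≤ Fintype.card K ^ m i.succ -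
            Fintype.card K ^ (m i.succ - ((j : ℕ) + 1)) - 1} =>
        Ideal.Quotient.mk (coinvIdeal (GSet K n m hmono hlast G))
          (∏ i : Fin l, ∏ j, X (emb n m hmono hlast i j) ^ b.1 i j))) = ⊤ := by
  classical
  set I := coinvIdeal (GSet K n m hmono hlast G) with hI
  rcases subsingleton_or_nontrivial (MvPolynomial (Fin n) K ⧸ I) with _ | _
  · exact Subsingleton.elim _ _
  let y : (Σ i : Fin l, Fin (m i.succ - m i.castSucc)) → MvPolynomial (Fin n) K ⧸ I :=
    fun a => Ideal.Quotient.mk I (X (emb n m hmono hlast a.1 a.2))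
  let d : (Σ i : Fin l, Fin (m i.succ - m i.castSucc)) → ℕ :=
    fun a => Fintype.card K ^ m a.1.succ - Fintype.card K ^ (m a.1.succ - ((a.2 : ℕ) + 1))
  let ρ : (Σ i : Fin l, Fin (m i.succ - m i.castSucc)) → ℕ :=
    fun a => emb n m hmono hlast a.1 a.2.rev
  have hρval : ∀ i (j : Fin (m i.succ - m i.castSucc)), ρ ⟨i, j⟩ = m i.succ - (j + 1) := by
    intro i j
    have := j.2
    simp only [ρ, emb_val, Fin.val_rev]
    omega
  have hd : ∀ a, 0 < d a := fun a => by
    have := a.2.2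
    exact Nat.sub_pos_of_lt (Nat.pow_lt_pow_right Fintype.one_lt_card (by omega))
  have hρ : Function.Injective ρ := by
    rintro ⟨i, j⟩ ⟨k, b⟩ h
    have := (embEquiv hm0 hmono hlast).injective (a₁ := ⟨i, j.rev⟩) (a₂ := ⟨k, b.rev⟩) (Fin.ext h)
    obtain ⟨rfl, h2⟩ := Sigma.mk.inj this
    rw [heq_eq_eq, Fin.rev_inj] at h2
    rw [h2]
  have H : ∀ a, ∃ p : Polynomial (Algebra.adjoin K (y '' {s | ρ s < ρ a})),
      p.Monic ∧ p.natDegree = d a ∧ Polynomial.aeval (y a) p = 0 := by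
    rintro ⟨i, j⟩
    have hj := j.2
    have hin : m i.succ ≤ n := hlast ▸ hmono.monotone (Fin.le_last _)
    let A : Finset (Fin n) := Finset.univ.filter fun s => (s : ℕ) < m i.succ
    let D : Finset (Fin n) := Finset.univ.filter fun s =>
      m i.castSucc ≤ (s : ℕ) ∧ (s : ℕ) ≤ m i.castSucc + j
    have hDA : D ⊆ A := by
      intro s
      simp only [A, D, Finset.mem_filter, Finset.mem_univ, true_and]
      omega
    have hA : A.card = m i.succ := card_filter_val_lt hin
    have hD : D.card = j + 1 := by
      have : D.map Fin.valEmbedding = Finset.Icc (m i.castSucc) (m i.castSucc + j) := by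
        ext s
        simp only [D, Finset.mem_map, Finset.mem_filter, Finset.mem_univ, true_and,
          Fin.valEmbedding_apply, Finset.mem_Icc]
        constructor
        · rintro ⟨a, ha, rfl⟩
          exact ha
        · intro hs
          exact ⟨⟨s, by omega⟩, hs, rfl⟩
      rw [← Finset.card_map Fin.valEmbedding, this, Nat.card_Icc]
      omega
    have := exists_monic_aeval_eq_zero (GSet K n m hmono hlast G) A (A \ D) Finset.sdiff_subset
      (fun g hg s t ht hs => GSet_apply_eq_zero hm0 hmono hlast G i hg
        (by simpa [A] using ht) (by simpa [A] using hs))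
      (emb n m hmono hlast i j) (hDA (by simp [D, emb_val])) (by simp [D, emb_val])
      (Algebra.adjoin K (y '' {s | ρ s < ρ ⟨i, j⟩})) ?_
    · rwa [Finset.card_sdiff_of_subset hDA, hA, hD] at this
    · intro s hs
      apply Algebra.subset_adjoin
      obtain ⟨k, b, rfl⟩ := exists_emb_eq hm0 hmono hlast s
      refine ⟨⟨k, b⟩, ?_, rfl⟩
      change ρ _ < ρ _
      rw [hρval, hρval]
      simp only [A, D, Finset.mem_sdiff, Finset.mem_filter, Finset.mem_univ, true_and,
        emb_val] at hs
      have hb := b.2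
      rcases lt_trichotomy k i with h | rfl | h
      · have := succ_le_castSucc_of_lt hmono h
        omega
      · omega
      · have := succ_le_castSucc_of_lt hmono h
        omega
  have key := adjoin_le_span_of_triangular y d hd ρ hρ H n
  rw [eq_top_iff]
  refine le_trans ?_ (key.trans (Submodule.span_mono ?_))
  · have hset : y '' {s | ρ s < n} = Ideal.Quotient.mkₐ K I '' Set.range X := by
      have : {s | ρ s < n} = Set.univ := Set.eq_univ_of_forall fun a => Fin.is_lt _
      rw [this, Set.image_univ, ← Set.range_comp]
      exact (embEquiv hm0 hmono hlast).surjective.range_comp (Ideal.Quotient.mkₐ K I ∘ X)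
    rw [hset, ← AlgHom.map_adjoin, adjoin_range_X, Algebra.map_top]
    intro x _
    exact Ideal.Quotient.mk_surjective x
  · rintro _ ⟨b, hb, -, rfl⟩
    refine ⟨⟨fun i j => b ⟨i, j⟩, fun i j => Nat.le_sub_one_of_lt (hb ⟨i, j⟩)⟩, ?_⟩
    rw [Fintype.prod_sigma]
    simp [y, map_prod]

/-- The block upper triangular matrix with diagonal blocks `h` and entries `u` above them. -/
noncomputable def blockMatrix {K : Type*} [Field K] {n l : ℕ} {m : Fin (l + 1) → ℕ}
    (hmono : StrictMono m) (hlast : m (Fin.last l) = n)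
    (h : (i : Fin l) → GL (Fin (m i.succ - m i.castSucc)) K)
    (u : (i : Fin l) → Fin (m i.succ - m i.castSucc) → Fin (m i.castSucc) → K) :
    Matrix (Σ i : Fin l, Fin (m i.succ - m i.castSucc))
      (Σ i : Fin l, Fin (m i.succ - m i.castSucc)) K :=
  fun a b => if hlt : (emb n m hmono hlast a.1 a.2 : ℕ) < m b.1.castSucc then u b.1 b.2 ⟨_, hlt⟩
    else if heq : a.1 = b.1 then
      (h b.1 : Matrix (Fin (m b.1.succ - m b.1.castSucc)) (Fin (m b.1.succ - m b.1.castSucc)) K)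
        (heq ▸ a.2) b.2
    else 0

theorem blockMatrix_diag {K : Type*} [Field K] {n l : ℕ} {m : Fin (l + 1) → ℕ}
    (hmono : StrictMono m) (hlast : m (Fin.last l) = n)
    (h : (i : Fin l) → GL (Fin (m i.succ - m i.castSucc)) K)
    (u : (i : Fin l) → Fin (m i.succ - m i.castSucc) → Fin (m i.castSucc) → K)
    (i : Fin l) (j k : Fin (m i.succ - m i.castSucc)) :
    blockMatrix hmono hlast h u ⟨i, j⟩ ⟨i, k⟩ =
      (h i : Matrix (Fin (m i.succ - m i.castSucc)) (Fin (m i.succ - m i.castSucc)) K) j k := by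
  rw [blockMatrix, dif_neg (by simp [emb_val]), dif_pos rfl]

theorem blockMatrix_blockTriangular {K : Type*} [Field K] {n l : ℕ} {m : Fin (l + 1) → ℕ}
    (hmono : StrictMono m) (hlast : m (Fin.last l) = n)
    (h : (i : Fin l) → GL (Fin (m i.succ - m i.castSucc)) K)
    (u : (i : Fin l) → Fin (m i.succ - m i.castSucc) → Fin (m i.castSucc) → K) :
    (blockMatrix hmono hlast h u).BlockTriangular Sigma.fst := by
  rintro ⟨i, a⟩ ⟨k, b⟩ hlt
  have h1 := succ_le_castSucc_of_lt hmono hlt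
  have h2 : m k.castSucc < m k.succ := hmono k.castSucc_lt_succ
  rw [blockMatrix, dif_neg (by simp only [emb_val]; simp only at h1; omega), dif_neg hlt.ne']

theorem isUnit_det_blockMatrix {K : Type*} [Field K] {n l : ℕ} {m : Fin (l + 1) → ℕ}
    (hmono : StrictMono m) (hlast : m (Fin.last l) = n)
    (h : (i : Fin l) → GL (Fin (m i.succ - m i.castSucc)) K)
    (u : (i : Fin l) → Fin (m i.succ - m i.castSucc) → Fin (m i.castSucc) → K) :
    IsUnit (blockMatrix hmono hlast h u).det := by
  rw [(blockMatrix_blockTriangular hmono hlast h u).det_fintype, isUnit_iff_ne_zero,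
    Finset.prod_ne_zero_iff]
  intro i _
  have : (blockMatrix hmono hlast h u).toSquareBlock Sigma.fst i =
      (h i : Matrix (Fin (m i.succ - m i.castSucc)) (Fin (m i.succ - m i.castSucc)) K).submatrix
        (Equiv.sigmaSubtype i) (Equiv.sigmaSubtype i) := by
    ext ⟨⟨_, a⟩, rfl⟩ ⟨⟨k, b⟩, hk⟩
    dsimp at hk
    subst hk
    exact blockMatrix_diag hmono hlast h u _ _ _
  rw [this, Matrix.det_submatrix_equiv_self]
  exact (Matrix.isUnits_det_units (h i)).ne_zero

/-- The parabolic subgroup has at least `∏ (q^{m_i} - q^{m_i-j})` elements. -/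
theorem prod_le_card_GSet {K : Type*} [Field K] [Fintype K] {n l : ℕ} {m : Fin (l + 1) → ℕ}
    (hm0 : m 0 = 0) (hmono : StrictMono m) (hlast : m (Fin.last l) = n) :
    ∏ i : Fin l, ∏ j : Fin (m i.succ - m i.castSucc), (Fintype.card K ^ m i.succ -
      Fintype.card K ^ (m i.succ - ((j : ℕ) + 1))) ≤
    Nat.card (GSet K n m hmono hlast fun _ => (⊤ : Subgroup _)) := by
  classical
  let E := embEquiv hm0 hmono hlast
  let f : ((i : Fin l) → GL (Fin (m i.succ - m i.castSucc)) K) ×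
      ((i : Fin l) → Fin (m i.succ - m i.castSucc) → Fin (m i.castSucc) → K) → GL (Fin n) K :=
    fun x => Matrix.GeneralLinearGroup.mkOfDetNeZero
      ((blockMatrix hmono hlast x.1 x.2).submatrix E.symm E.symm) (by
        rw [Matrix.det_submatrix_equiv_self]
        exact (isUnit_det_blockMatrix hmono hlast x.1 x.2).ne_zero)
  have hf : ∀ x a b, (f x : Matrix (Fin n) (Fin n) K) (emb n m hmono hlast a.1 a.2)
      (emb n m hmono hlast b.1 b.2) = blockMatrix hmono hlast x.1 x.2 a b := by
    intro x a b
    change blockMatrix hmono hlast x.1 x.2 (E.symm (E a)) (E.symm (E b)) = _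
    rw [E.symm_apply_apply, E.symm_apply_apply]
  have hmem : ∀ x, f x ∈ GSet K n m hmono hlast fun _ => (⊤ : Subgroup _) := by
    intro x
    refine ⟨fun s t hst => ?_, fun i => ⟨x.1 i, trivial, fun j k => ?_⟩⟩
    · obtain ⟨i, a, rfl⟩ := exists_emb_eq hm0 hmono hlast s
      obtain ⟨k, b, rfl⟩ := exists_emb_eq hm0 hmono hlast t
      rw [tauf_emb, tauf_emb, hmono.lt_iff_lt, Fin.castSucc_lt_castSucc_iff] at hst
      rw [hf x ⟨i, a⟩ ⟨k, b⟩]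
      exact blockMatrix_blockTriangular hmono hlast x.1 x.2 hst
    · rw [hf x ⟨i, j⟩ ⟨i, k⟩, blockMatrix_diag]
  have hinj : Function.Injective f := by
    intro x x' hxx
    have hB : ∀ a b, blockMatrix hmono hlast x.1 x.2 a b = blockMatrix hmono hlast x'.1 x'.2 a b :=
      fun a b => by rw [← hf, ← hf, hxx]
    refine Prod.ext (funext fun i => Units.ext (Matrix.ext fun j k => ?_))
      (funext fun i => funext fun j => funext fun s => ?_)
    · have := hB ⟨i, j⟩ ⟨i, k⟩
      rwa [blockMatrix_diag, blockMatrix_diag] at this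
    · have hi : m i.castSucc ≤ n := hlast ▸ hmono.monotone (Fin.le_last _)
      obtain ⟨k, a, hka⟩ := exists_emb_eq hm0 hmono hlast (Fin.castLE hi s)
      have hval : (emb n m hmono hlast k a : ℕ) = s := by rw [hka]; rfl
      have := hB ⟨k, a⟩ ⟨i, j⟩
      rw [blockMatrix, blockMatrix, dif_pos (by rw [hval]; exact s.2),
        dif_pos (by rw [hval]; exact s.2)] at this
      have hs : (⟨(emb n m hmono hlast k a : ℕ), by rw [hval]; exact s.2⟩ : Fin (m i.castSucc)) =
        s := Fin.ext hval
      rwa [hs] at this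
  have hle := Nat.card_le_card_of_injective (fun x => (⟨f x, hmem x⟩ :
    GSet K n m hmono hlast fun _ => (⊤ : Subgroup _))) fun x y hxy =>
      hinj (congrArg Subtype.val hxy)
  refine le_trans (le_of_eq ?_) hle
  rw [Nat.card_prod, Nat.card_pi, Nat.card_pi, ← Finset.prod_mul_distrib]
  refine Finset.prod_congr rfl fun i _ => ?_
  have hi : m i.castSucc < m i.succ := hmono i.castSucc_lt_succ
  rw [Matrix.card_GL_field, Nat.card_pi, ← Finset.prod_mul_distrib, ← Equiv.prod_comp Fin.revPerm]
  refine Finset.prod_congr rfl fun j _ => ?_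
  have hj := j.2
  rw [Nat.card_fun, Nat.card_eq_fintype_card, Nat.card_eq_fintype_card, Fintype.card_fin,
    Nat.sub_mul, ← pow_add, ← pow_add, Fin.revPerm_apply, Fin.val_rev]
  congr 2 <;> omega

/-- for the parabolic subgroup `GL_I` (the group `G_I` with
`G_i = GL_{n_i}(F_q)`, i.e. each diagonal-block subgroup equal to the full
general linear group), the monomial `Π_{i,j} x_{m_{i-1}+j}^{q^{m_i}-q^{m_i-j}-1}`
generates a block basis for the coinvariant algebra `P_{GL_I}`: its monomial
factors project to an `F_q`-basis of `P/I_{GL_I}`. -/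
theorem statement17 {K : Type*} [Field K] [Fintype K] {p r : ℕ} (hp : p.Prime)
    (hr : 0 < r) (hcard : Fintype.card K = p ^ r)
    (n l : ℕ) (hl : 0 < l) (m : Fin (l + 1) → ℕ)
    (hm0 : m 0 = 0) (hmono : StrictMono m) (hlast : m (Fin.last l) = n) :
    LinearIndependent K
      (fun b : {b : (i : Fin l) → Fin (m i.succ - m i.castSucc) → ℕ //
          ∀ i j, b i j ≤ Fintype.card K ^ m i.succ -
            Fintype.card K ^ (m i.succ - ((j : ℕ) + 1)) - 1} =>
        Ideal.Quotient.mk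
          (coinvIdeal (GSet K n m hmono hlast (fun _ => (⊤ : Subgroup _))))
          (∏ i : Fin l, ∏ j, X (emb n m hmono hlast i j) ^ b.1 i j)) ∧
    Submodule.span K
      (Set.range (fun b : {b : (i : Fin l) → Fin (m i.succ - m i.castSucc) → ℕ //
          ∀ i j, b i j ≤ Fintype.card K ^ m i.succ -
            Fintype.card K ^ (m i.succ - ((j : ℕ) + 1)) - 1} =>
        Ideal.Quotient.mk
          (coinvIdeal (GSet K n m hmono hlast (fun _ => (⊤ : Subgroup _))))
          (∏ i : Fin l, ∏ j, X (emb n m hmono hlast i j) ^ b.1 i j))) = ⊤ := by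
  classical
  have hspan := span_monomials_eq_top (K := K) hm0 hmono hlast fun _ => ⊤
  refine ⟨?_, hspan⟩
  let d : (i : Fin l) → Fin (m i.succ - m i.castSucc) → ℕ := fun i j =>
    Fintype.card K ^ m i.succ - Fintype.card K ^ (m i.succ - ((j : ℕ) + 1))
  have hd : ∀ i j, 0 < d i j := fun i j =>
    Nat.sub_pos_of_lt (Nat.pow_lt_pow_right Fintype.one_lt_card (by have := j.2; omega))
  let toFin : {b : (i : Fin l) → Fin (m i.succ - m i.castSucc) → ℕ //
      ∀ i j, b i j ≤ d i j - 1} → (i : Fin l) → (j : Fin (m i.succ - m i.castSucc)) →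
        Fin (d i j) := fun b i j => ⟨b.1 i j, by have := b.2 i j; have := hd i j; omega⟩
  have htoFin : Function.Injective toFin := fun b c h => Subtype.ext <| funext fun i =>
    funext fun j => congrArg Fin.val (congrFun (congrFun h i) j)
  have := Finite.of_injective toFin htoFin
  have hcard_le : Nat.card {b : (i : Fin l) → Fin (m i.succ - m i.castSucc) → ℕ //
      ∀ i j, b i j ≤ d i j - 1} ≤
        Nat.card (GSet K n m hmono hlast fun _ => (⊤ : Subgroup _)) := by
    refine (Nat.card_le_card_of_injective toFin htoFin).trans ?_
    simpa [Nat.card_pi] using prod_le_card_GSet (K := K) hm0 hmono hlast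
  obtain ⟨κ, a, ha, hsp, hli⟩ := exists_linearIndependent' K
    (fun b : {b : (i : Fin l) → Fin (m i.succ - m i.castSucc) → ℕ //
          ∀ i j, b i j ≤ d i j - 1} =>
        Ideal.Quotient.mk
          (coinvIdeal (GSet K n m hmono hlast (fun _ => (⊤ : Subgroup _))))
          (∏ i : Fin l, ∏ j, X (emb n m hmono hlast i j) ^ b.1 i j))
  have := Finite.of_injective a ha
  have := Fintype.ofFinite κ
  have hle := card_le_card_of_span_coinvariants
    (GSet K n m hmono hlast (fun _ => (⊤ : Subgroup _)))
    (fun k : κ => ∑ i : Fin l, ∑ j, Finsupp.single (emb n m hmono hlast i j) ((a k).1 i j)) (by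
      rw [← hspan, ← hsp]
      simp only [monomial_sum_one, Function.comp_def, X_pow_eq_monomial])
  rw [← Nat.card_eq_fintype_card] at hle
  have hbij : Function.Bijective a :=
    (Nat.bijective_iff_injective_and_card a).2
      ⟨ha, le_antisymm (Nat.card_le_card_of_injective a ha) (hcard_le.trans hle)⟩
  exact (linearIndependent_equiv (Equiv.ofBijective a hbij)).1 hli
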